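/- The assignment X ↦ (det(X), det₁(X)) defines a bijection from the set of admissible sequences onto the set {(r₀, r₁) ∈ ℕ² : 0 ≤ r₁ < r₀ and gcd(r₀, r₁) = 1}. -/

import Mathlib

/-- The determinant of the matrix `-M(X)`, where `M(X)` is the intersection matrix of
the sequence `X` (diagonal `xᵢ`, `1` on the off-diagonals `|i-j| = 1`); `det(∅) = 1`. -/
def seqDet : List ℤ → ℤ
  | [] => 1
  | [x] => -x
  | x :: y :: l => -x * seqDet (y :: l) - seqDet l

/-- `det₁(x₁,…,xₙ) = det(x₂,…,xₙ)`, with `det₁(∅) = 0`. -/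
def seqDet1 : List ℤ → ℤ
  | [] => 0
  | _ :: l => seqDet l

/-- A sequence is admissible if every term is `< -1`. -/
def IsAdmissible (A : List ℤ) : Prop := ∀ a ∈ A, a < -1

/-- A canonical sequence: `(0^r, A)` with `A` admissible and `r` even if `A ≠ ∅`. -/
def IsCanonicalSeq (C : List ℤ) : Prop :=
  ∃ (r : ℕ) (A : List ℤ), IsAdmissible A ∧ (A ≠ [] → Even r) ∧
    C = List.replicate r 0 ++ A

theorem seqDet_cons (x : ℤ) (l : List ℤ) :
    seqDet (x :: l) = -x * seqDet l - seqDet1 l := by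
  cases l <;> simp [seqDet, seqDet1]

theorem isAdmissible_cons {x : ℤ} {l : List ℤ} :
    IsAdmissible (x :: l) ↔ x < -1 ∧ IsAdmissible l := by
  simp [IsAdmissible]

theorem IsAdmissible.seqDet_bounds {X : List ℤ} (hX : IsAdmissible X) :
    0 ≤ seqDet1 X ∧ seqDet1 X < seqDet X := by
  induction X with
  | nil => simp [seqDet, seqDet1]
  | cons x l ih =>
    obtain ⟨hx, hl⟩ := isAdmissible_cons.1 hX
    obtain ⟨h0, h1⟩ := ih hl
    rw [seqDet_cons]
    change 0 ≤ seqDet l ∧ seqDet l < _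
    exact ⟨by linarith, by nlinarith⟩

theorem isCoprime_seqDet_seqDet1 (X : List ℤ) : IsCoprime (seqDet X) (seqDet1 X) := by
  induction X with
  | nil => exact isCoprime_one_left
  | cons x l ih =>
    obtain ⟨u, v, h⟩ := ih
    rw [seqDet_cons]
    exact ⟨-v, u - v * x, by simp only [seqDet1] at h ⊢; linear_combination h⟩

theorem IsAdmissible.eq_of_seqDet_eq {X Y : List ℤ} (hX : IsAdmissible X) (hY : IsAdmissible Y)
    (h0 : seqDet X = seqDet Y) (h1 : seqDet1 X = seqDet1 Y) : X = Y := by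
  induction X generalizing Y with
  | nil =>
    cases Y with
    | nil => rfl
    | cons y m =>
      have hm := (isAdmissible_cons.1 hY).2.seqDet_bounds
      simp only [seqDet1] at h1 hm
      lia
  | cons x l ih =>
    obtain ⟨-, hl⟩ := isAdmissible_cons.1 hX
    have bl := hl.seqDet_bounds
    cases Y with
    | nil =>
      simp only [seqDet1] at h1 bl
      lia
    | cons y m =>
      obtain ⟨-, hm⟩ := isAdmissible_cons.1 hY
      have bm := hm.seqDet_bounds
      rw [seqDet_cons, seqDet_cons] at h0
      change seqDet l = seqDet m at h1
      rw [← h1] at h0 bm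
      have hxy : x = y := by
        rcases lt_trichotomy x y with h | h | h
        · nlinarith
        · exact h
        · nlinarith
      subst hxy
      rw [ih hl hm h1 (by linarith)]

theorem exists_isAdmissible_seqDet_eq {a b : ℤ} (hb : 0 ≤ b) (hab : b < a)
    (h : IsCoprime a b) : ∃ X, IsAdmissible X ∧ seqDet X = a ∧ seqDet1 X = b := by
  induction hn : b.toNat using Nat.strong_induction_on generalizing a b with
  | _ n ih =>
    rcases hb.eq_or_lt with rfl | hb'
    · have ha : a = 1 := by
        rcases Int.isUnit_iff.1 (isCoprime_zero_right.1 h) with h | h <;> lia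
      exact ⟨[], by simp [IsAdmissible], by simp [seqDet, ha], rfl⟩
    · have hdiv := Int.mul_ediv_add_emod (-a) b
      have hr := Int.emod_nonneg (-a) hb'.ne'
      have hr' := Int.emod_lt_of_pos (-a) hb'
      generalize (-a) / b = x at *
      generalize (-a) % b = r at *
      have hco : IsCoprime b r := by
        obtain ⟨u, v, huv⟩ := h
        exact ⟨v - u * x, -u, by linear_combination huv - u * hdiv⟩
      obtain ⟨l, hl, hl0, hl1⟩ := ih r.toNat (by lia) hr hr' hco rfl
      refine ⟨x :: l, isAdmissible_cons.2 ⟨by nlinarith, hl⟩, ?_, hl0⟩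
      rw [seqDet_cons, hl0, hl1]
      linarith

/-- **Lemma.** `X ↦ (det(X), det₁(X))` is a bijection from the set of admissible
sequences onto `{(r₀, r₁) : 0 ≤ r₁ < r₀ and gcd(r₀, r₁) = 1}`. -/
theorem admissible_det_bijection :
    Set.BijOn (fun X => (seqDet X, seqDet1 X)) {X : List ℤ | IsAdmissible X}
      {p : ℤ × ℤ | 0 ≤ p.2 ∧ p.2 < p.1 ∧ Int.gcd p.1 p.2 = 1} := by
  refine ⟨fun X hX => ?_, fun X hX Y hY h => ?_, fun p hp => ?_⟩
  · obtain ⟨h0, h1⟩ := IsAdmissible.seqDet_bounds hX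
    exact ⟨h0, h1, Int.isCoprime_iff_gcd_eq_one.1 (isCoprime_seqDet_seqDet1 X)⟩
  · exact IsAdmissible.eq_of_seqDet_eq hX hY (congrArg Prod.fst h) (congrArg Prod.snd h)
  · obtain ⟨h0, h1, h⟩ := hp
    obtain ⟨X, hX, hX0, hX1⟩ :=
      exists_isAdmissible_seqDet_eq h0 h1 (Int.isCoprime_iff_gcd_eq_one.2 h)
    exact ⟨X, hX, Prod.ext hX0 hX1⟩
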